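/- arXiv:1709.09485 — 2 statements merged into one kernel-verified Lean document; each statement's English description precedes it below -/
import Mathlib

section
/- Let n ≥ 1 and let H be a non-negative self-adjoint operator on L²(ℝⁿ) whose heat semigroup satisfies the decay estimate ‖e^{−tH}‖_{L²→L^∞} ≤ C t^{−γ} for all t > 0 and some γ > 0. Then for every R > 0 there exist a constant δ_R > 0 and a constant C' > 0 such that for all f ∈ L²(ℝⁿ): ‖f‖² ≤ C' ( ‖χ(|x| ≥ R) f‖² + ‖χ(H ≥ δ_R) f‖² ). -/
open MeasureTheory

noncomputable section

variable (n : ℕ)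

local notation "E" => EuclideanSpace ℝ (Fin n)
local notation "L2" => MeasureTheory.Lp ℂ 2 (volume : Measure (EuclideanSpace ℝ (Fin n)))

/-- The square of the `L²` norm is the integral of the squared pointwise norm. -/
theorem norm_sq_eq_integral_norm_sq {α : Type*} [MeasurableSpace α] {μ : Measure α}
    (f : Lp ℂ 2 μ) : ‖f‖ ^ 2 = ∫ x, ‖f x‖ ^ 2 ∂μ := by
  have h : inner ℂ f f = ((∫ x, ‖f x‖ ^ 2 ∂μ : ℝ) : ℂ) := by
    rw [L2.inner_def, ← integral_complex_ofReal]
    refine integral_congr_ae (Filter.Eventually.of_forall fun x => ?_)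
    simp [inner_self_eq_norm_sq_to_K]
  rw [inner_self_eq_norm_sq_to_K] at h
  exact Complex.ofReal_injective (by simpa using h)

theorem integrable_norm_sq_coeFn {α : Type*} [MeasurableSpace α] {μ : Measure α}
    (f : Lp ℂ 2 μ) : Integrable (fun x => ‖f x‖ ^ 2) μ := by
  have := (Lp.memLp f).integrable_norm_pow (by norm_num)
  simpa using this

/-- An essential bound on `u` bounds its `L²` mass on a set of finite measure. -/
theorem setIntegral_norm_sq_le_of_eLpNorm_top_le {α : Type*} [MeasurableSpace α]
    {μ : Measure α} (u : Lp ℂ 2 μ) {B : Set α} (hB : μ B < ⊤) {M : ℝ} (hM : 0 ≤ M)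
    (h : eLpNorm u ⊤ μ ≤ ENNReal.ofReal M) :
    ∫ x in B, ‖u x‖ ^ 2 ∂μ ≤ M ^ 2 * μ.real B := by
  have hae : ∀ᵐ x ∂μ, ‖u x‖ ≤ M := by
    rw [eLpNorm_exponent_top] at h
    filter_upwards [ae_le_eLpNormEssSup (f := u) (μ := μ)] with x hx
    have := hx.trans h
    rwa [← ofReal_norm, ENNReal.ofReal_le_ofReal_iff hM] at this
  have hle : ∫ x in B, ‖u x‖ ^ 2 ∂μ ≤ ∫ _ in B, M ^ 2 ∂μ := by
    refine integral_mono_ae (integrable_norm_sq_coeFn u).integrableOn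
      (integrableOn_const hB.ne) ?_
    filter_upwards [ae_restrict_of_ae hae] with x hx
    exact pow_le_pow_left₀ (norm_nonneg _) hx 2
  refine hle.trans_eq ?_
  simp [mul_comm]

theorem setIntegral_norm_sq_add_le {α : Type*} [MeasurableSpace α] {μ : Measure α}
    (u v : Lp ℂ 2 μ) (B : Set α) :
    ∫ x in B, ‖(u + v) x‖ ^ 2 ∂μ ≤ 2 * (∫ x in B, ‖u x‖ ^ 2 ∂μ) + 2 * ‖v‖ ^ 2 := by
  have hle : ∫ x in B, ‖(u + v) x‖ ^ 2 ∂μ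
      ≤ ∫ x in B, (2 * ‖u x‖ ^ 2 + 2 * ‖v x‖ ^ 2) ∂μ := by
    refine integral_mono_ae (integrable_norm_sq_coeFn _).integrableOn
      (((integrable_norm_sq_coeFn u).const_mul 2).add
        ((integrable_norm_sq_coeFn v).const_mul 2)).integrableOn ?_
    filter_upwards [ae_restrict_of_ae (Lp.coeFn_add u v)] with x hx
    have h1 : ‖(u + v) x‖ ≤ ‖u x‖ + ‖v x‖ := by
      rw [hx]; exact norm_add_le _ _
    have h2 := pow_le_pow_left₀ (norm_nonneg _) h1 2
    nlinarith [sq_nonneg (‖u x‖ - ‖v x‖)]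
  have hv : ∫ x in B, ‖v x‖ ^ 2 ∂μ ≤ ‖v‖ ^ 2 := by
    rw [norm_sq_eq_integral_norm_sq v]
    exact setIntegral_le_integral (integrable_norm_sq_coeFn v)
      (Filter.Eventually.of_forall fun x => sq_nonneg _)
  rw [integral_add ((integrable_norm_sq_coeFn u).const_mul 2).integrableOn
    ((integrable_norm_sq_coeFn v).const_mul 2).integrableOn, integral_const_mul,
    integral_const_mul] at hle
  linarith

/-- If the contraction `T = S²` with `S` self-adjoint satisfies `‖S g‖² ≥ (1 - ε) ‖g‖²`,
then `T g` is close to `g`. -/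
theorem norm_sub_sq_le_of_selfAdjoint_sqrt {V : Type*} [NormedAddCommGroup V]
    [InnerProductSpace ℂ V] [CompleteSpace V] {S T : V →L[ℂ] V} (hS : IsSelfAdjoint S)
    (hT : T = S.comp S) (hT1 : ‖T‖ ≤ 1) {g : V} {ε : ℝ}
    (hg : (1 - ε) * ‖g‖ ^ 2 ≤ ‖S g‖ ^ 2) :
    ‖g - T g‖ ^ 2 ≤ 2 * ε * ‖g‖ ^ 2 := by
  have hinner : RCLike.re (inner ℂ g (T g)) = ‖S g‖ ^ 2 := by
    rw [hT, ContinuousLinearMap.comp_apply, ← ContinuousLinearMap.adjoint_inner_left,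
      ContinuousLinearMap.isSelfAdjoint_iff'.mp hS, ← norm_sq_eq_re_inner]
  have hTg : ‖T g‖ ^ 2 ≤ ‖g‖ ^ 2 :=
    pow_le_pow_left₀ (norm_nonneg _) (by simpa using T.le_of_opNorm_le hT1 g) 2
  rw [norm_sub_sq (𝕜 := ℂ), hinner]
  linarith

theorem norm_sub_apply_le_of_isSelfAdjoint_idempotent {V : Type*} [NormedAddCommGroup V]
    [InnerProductSpace ℂ V] [CompleteSpace V] {Q : V →L[ℂ] V} (hQ : IsIdempotentElem Q)
    (hQs : IsSelfAdjoint Q) (f : V) : ‖f - Q f‖ ≤ ‖f‖ := by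
  have hQQ : Q (Q f) = Q f := congrArg (fun A : V →L[ℂ] V => A f) hQ.eq
  have h0 : inner ℂ (f - Q f) (Q f) = 0 := by
    rw [← ContinuousLinearMap.adjoint_inner_left,
      ContinuousLinearMap.isSelfAdjoint_iff'.mp hQs, map_sub, hQQ, sub_self, inner_zero_left]
  have h1 := norm_add_sq (𝕜 := ℂ) (f - Q f) (Q f)
  rw [h0, sub_add_cancel] at h1
  refine le_of_sq_le_sq ?_ (norm_nonneg f)
  simp only [map_zero] at h1
  nlinarith [sq_nonneg ‖Q f‖]

/-- **Abstract Nazarov-type uncertainty principle from heat-kernel decay.**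
Let `n ≥ 1` and let `H` be a non-negative self-adjoint operator on `L²(ℝⁿ)`.  `H` is
represented here by its heat semigroup `heat t = e^{−tH}` (a self-adjoint contraction
semigroup) together with its spectral projections `P δ = χ(H ≥ δ)`; the hypotheses
`hP_one`, `hPcomm`, `hhigh`, `hlow` express that `P δ` is exactly the spectral projection
of the (non-negative) generator onto `[δ, ∞)`.  Assume the `L² → L^∞` decay
`‖e^{−tH}‖_{L²→L^∞} ≤ C t^{−γ}` for all `t > 0` and some `γ > 0`.  Then for every `R > 0`
there are constants `δ_R > 0` and `C' > 0` such that for all `f ∈ L²(ℝⁿ)`: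
`‖f‖² ≤ C' (‖χ(|x| ≥ R) f‖² + ‖χ(H ≥ δ_R) f‖²)`. -/
theorem abstract_uncertainty_principle
    (hn : 1 ≤ n)
    (heat : ℝ → (L2 →L[ℂ] L2)) (P : ℝ → (L2 →L[ℂ] L2))
    (hheat_zero : heat 0 = 1)
    (hheat_add : ∀ s t : ℝ, 0 ≤ s → 0 ≤ t → heat (s + t) = (heat s).comp (heat t))
    (hheat_sa : ∀ t : ℝ, 0 ≤ t → IsSelfAdjoint (heat t))
    (hheat_contr : ∀ t : ℝ, 0 ≤ t → ‖heat t‖ ≤ 1)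
    (hP_proj : ∀ δ : ℝ, IsIdempotentElem (P δ) ∧ IsSelfAdjoint (P δ))
    (hP_one : ∀ δ : ℝ, δ ≤ 0 → P δ = 1)
    (hP_mono : ∀ δ₁ δ₂ : ℝ, δ₁ ≤ δ₂ → (P δ₂).comp (P δ₁) = P δ₂)
    (hPcomm : ∀ (δ t : ℝ), 0 ≤ t → (heat t).comp (P δ) = (P δ).comp (heat t))
    (hhigh : ∀ (δ t : ℝ) (f : L2), 0 ≤ t →
      ‖heat t (P δ f)‖ ≤ Real.exp (-(t * δ)) * ‖P δ f‖)
    (hlow : ∀ (δ t : ℝ) (f : L2), 0 ≤ t → P δ f = 0 →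
      Real.exp (-(t * δ)) * ‖f‖ ≤ ‖heat t f‖)
    (C γ : ℝ) (hC : 0 < C) (hγ : 0 < γ)
    (hdecay : ∀ t : ℝ, 0 < t → ∀ f : L2,
      eLpNorm (⇑(heat t f)) ⊤ volume ≤ ENNReal.ofReal (C * t ^ (-γ) * ‖f‖)) :
    ∀ R > (0 : ℝ), ∃ δR > (0 : ℝ), ∃ C' > (0 : ℝ), ∀ f : L2,
      ‖f‖ ^ 2 ≤ C' * ((∫ x in {x : E | R ≤ ‖x‖}, ‖f x‖ ^ 2) + ‖P δR f‖ ^ 2) := by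
  intro R hR
  set B : Set E := {x : E | R ≤ ‖x‖}ᶜ with hBdef
  have hBm : MeasurableSet {x : E | R ≤ ‖x‖} :=
    (isClosed_le continuous_const continuous_norm).measurableSet
  have hBfin : volume B < ⊤ := by
    have hsub : B ⊆ Metric.ball 0 R := fun x hx => by simpa [hBdef] using hx
    exact (measure_mono hsub).trans_lt measure_ball_lt_top
  obtain ⟨t, ht, htsmall⟩ :
      ∃ t : ℝ, 0 < t ∧ (C * t ^ (-γ)) ^ 2 * volume.real B ≤ 1 / 8 := by
    have hlim : Filter.Tendsto (fun t : ℝ => (C * t ^ (-γ)) ^ 2 * volume.real B)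
        Filter.atTop (nhds 0) := by
      simpa using (((tendsto_rpow_neg_atTop hγ).const_mul C).pow 2).mul_const (volume.real B)
    obtain ⟨t, h1, h2⟩ := ((Filter.eventually_gt_atTop 0).and
      (hlim.eventually_le_const (by norm_num : (0 : ℝ) < 1 / 8))).exists
    exact ⟨t, h1, h2⟩
  refine ⟨1 / (32 * t), by positivity, 8, by norm_num, fun f => ?_⟩
  set δ : ℝ := 1 / (32 * t) with hδ
  obtain ⟨hidem, hsa⟩ := hP_proj δ
  set g : L2 := f - P δ f with hg
  have hPg : P δ g = 0 := by
    have hPP : P δ (P δ f) = P δ f := congrArg (fun A : L2 →L[ℂ] L2 => A f) hidem.eq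
    rw [hg, map_sub, hPP, sub_self]
  have hgf : ‖g‖ ^ 2 ≤ ‖f‖ ^ 2 :=
    pow_le_pow_left₀ (norm_nonneg _)
      (norm_sub_apply_le_of_isSelfAdjoint_idempotent hidem hsa f) 2
  have ht2 : 0 ≤ t / 2 := by positivity
  have hclose : ‖g - heat t g‖ ^ 2 ≤ 2 * (1 / 32) * ‖g‖ ^ 2 := by
    refine norm_sub_sq_le_of_selfAdjoint_sqrt (hheat_sa _ ht2)
      (by rw [← hheat_add _ _ ht2 ht2, add_halves]) (hheat_contr t ht.le) ?_
    have h1 := pow_le_pow_left₀ (by positivity) (hlow δ (t / 2) g ht2 hPg) 2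
    have h2 : Real.exp (-(t / 2 * δ)) ^ 2 = Real.exp (-(1 / 32)) := by
      rw [← Real.exp_nat_mul, hδ]
      congr 1
      field_simp
      norm_num
    rw [mul_pow, h2] at h1
    refine le_trans ?_ h1
    gcongr
    linarith [Real.add_one_le_exp (-(1 / 32 : ℝ))]
  have hu : ∫ x in B, ‖heat t g x‖ ^ 2 ≤ 1 / 8 * ‖g‖ ^ 2 := by
    refine (setIntegral_norm_sq_le_of_eLpNorm_top_le _ hBfin (by positivity)
      (hdecay t ht g)).trans ?_
    calc (C * t ^ (-γ) * ‖g‖) ^ 2 * volume.real B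
        = (C * t ^ (-γ)) ^ 2 * volume.real B * ‖g‖ ^ 2 := by ring
      _ ≤ 1 / 8 * ‖g‖ ^ 2 := by gcongr
  have hv : ‖g - heat t g + P δ f‖ ^ 2 ≤ 2 * ‖g - heat t g‖ ^ 2 + 2 * ‖P δ f‖ ^ 2 := by
    have h := pow_le_pow_left₀ (norm_nonneg _) (norm_add_le (g - heat t g) (P δ f)) 2
    nlinarith [sq_nonneg (‖g - heat t g‖ - ‖P δ f‖)]
  have hsum := setIntegral_norm_sq_add_le (heat t g) (g - heat t g + P δ f) B
  have hf : heat t g + (g - heat t g + P δ f) = f := by rw [hg]; abel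
  rw [hf] at hsum
  have hsplit := integral_add_compl hBm (integrable_norm_sq_coeFn f)
  rw [← norm_sq_eq_integral_norm_sq f] at hsplit
  have hpos : 0 ≤ ∫ x in {x : E | R ≤ ‖x‖}, ‖f x‖ ^ 2 :=
    integral_nonneg fun x => sq_nonneg _
  linarith

end
end

section
/- Let n ≥ 1 and let H be a non-negative self-adjoint operator on L²(ℝⁿ) satisfying ‖e^{−tH}‖_{L²→L^∞} ≤ C t^{−γ} for all t > 0 and some γ > 0. Then for every α > γ there is a constant C' such that for all ε₀ > 0: (a) ‖(H+ε₀)^{−α}‖_{L²→L^∞} ≤ C' ε₀^{γ−α}; and (b) for every R > 0 the operator χ(|x| ≤ R)(H+ε₀)^{−α} is a Hilbert–Schmidt operator on L²(ℝⁿ) whose Hilbert–Schmidt norm (and hence operator norm) is at most C' R^{n/2} ε₀^{γ−α}. -/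
open MeasureTheory
open scoped ENNReal NNReal

noncomputable section

section AEBounds

variable {Ω : Type*} {mΩ : MeasurableSpace Ω} {μ : Measure Ω}

/-- An almost everywhere bound on all directional components, with the exceptional null set
allowed to depend on the direction, gives an almost everywhere bound on the norm. -/
lemma ae_norm_le_of_forall_ae_re_inner_le {F : Type*} [NormedAddCommGroup F]
    [InnerProductSpace ℂ F] [TopologicalSpace.SeparableSpace F] {u : Ω → F} {K : ℝ} (hK : 0 ≤ K)
    (h : ∀ c : F, ∀ᵐ x ∂μ, (inner ℂ c (u x)).re ≤ K * ‖c‖) :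
    ∀ᵐ x ∂μ, ‖u x‖ ≤ K := by
  have h_dense := ae_all_iff.2 fun k : ℕ => h (TopologicalSpace.denseSeq F k)
  filter_upwards [h_dense] with x hx
  have h_closed : IsClosed {c : F | (inner ℂ c (u x)).re ≤ K * ‖c‖} :=
    isClosed_le (by fun_prop) (by fun_prop)
  have h_all : ∀ c : F, (inner ℂ c (u x)).re ≤ K * ‖c‖ := fun c =>
    (TopologicalSpace.denseRange_denseSeq F).induction_on c h_closed hx
  have h_self := h_all (u x)
  have h_sq : (inner ℂ (u x) (u x)).re = ‖u x‖ ^ 2 := inner_self_eq_norm_sq (𝕜 := ℂ) (u x)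
  rw [h_sq] at h_self
  by_contra! hlt
  nlinarith [norm_nonneg (u x)]

lemma ae_norm_le_of_forall_norm_setIntegral_le [SigmaFinite μ] {g : Ω → ℂ} {M : ℝ} (hM : 0 ≤ M)
    (hg : ∀ s, MeasurableSet s → μ s < ∞ → IntegrableOn g s μ)
    (h : ∀ s, MeasurableSet s → μ s < ∞ → ‖∫ x in s, g x ∂μ‖ ≤ M * μ.real s) :
    ∀ᵐ x ∂μ, ‖g x‖ ≤ M := by
  refine ae_norm_le_of_forall_ae_re_inner_le hM fun c => ?_
  have h_int : ∀ s, MeasurableSet s → μ s < ∞ →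
      IntegrableOn (fun x => (inner ℂ c (g x)).re) s μ := fun s hs hμs =>
    Integrable.re (𝕜 := ℂ) ((hg s hs hμs).const_inner c)
  have h_nonneg : 0 ≤ᵐ[μ] fun x => M * ‖c‖ - (inner ℂ c (g x)).re := by
    have h_const : ∀ s, μ s < ∞ → IntegrableOn (fun _ => M * ‖c‖) s μ := fun s hμs =>
      integrableOn_const hμs.ne
    refine ae_nonneg_of_forall_setIntegral_nonneg_of_sigmaFinite
      (fun s hs hμs => (h_const s hμs).sub (h_int s hs hμs)) fun s hs hμs => ?_
    rw [integral_sub (h_const s hμs) (h_int s hs hμs), setIntegral_const,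
      smul_eq_mul, sub_nonneg]
    calc ∫ x in s, (inner ℂ c (g x)).re ∂μ
        = (inner ℂ c (∫ x in s, g x ∂μ)).re := by
          rw [← integral_inner (hg s hs hμs) c]
          exact integral_re (𝕜 := ℂ) ((hg s hs hμs).const_inner c)
      _ ≤ ‖c‖ * ‖∫ x in s, g x ∂μ‖ := (Complex.re_le_norm _).trans (norm_inner_le_norm _ _)
      _ ≤ ‖c‖ * (M * μ.real s) := by gcongr; exact h s hs hμs
      _ = μ.real s * (M * ‖c‖) := by ring
  filter_upwards [h_nonneg] with x hx using sub_nonneg.1 hx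

/-- Minkowski's inequality in `L^∞` for a Bochner integral taken in `L²`. -/
lemma ae_norm_integral_le_of_ae_bound [SigmaFinite μ] {T : Type*} {mT : MeasurableSpace T}
    {ν : Measure T} {G : T → Lp ℂ 2 μ} {φ : T → ℝ} (hφ : Integrable φ ν) (hφ0 : 0 ≤ᵐ[ν] φ)
    (h : ∀ᵐ t ∂ν, ∀ᵐ x ∂μ, ‖G t x‖ ≤ φ t) :
    ∀ᵐ x ∂μ, ‖(∫ t, G t ∂ν : Lp ℂ 2 μ) x‖ ≤ ∫ t, φ t ∂ν := by
  have hM : 0 ≤ ∫ t, φ t ∂ν := integral_nonneg_of_ae hφ0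
  by_cases hG : Integrable G ν
  · refine ae_norm_le_of_forall_norm_setIntegral_le hM
      (fun s _ hμs => integrableOn_Lp_of_measure_ne_top _ (by norm_num) hμs.ne)
      fun s hs hμs => ?_
    rw [← L2.inner_indicatorConstLp_one hs hμs.ne, ← integral_inner hG, ← integral_mul_const]
    refine norm_integral_le_of_norm_le (hφ.mul_const _) ?_
    filter_upwards [h] with t ht
    rw [L2.inner_indicatorConstLp_one hs hμs.ne]
    exact norm_setIntegral_le_of_norm_le_const_ae hμs (ae_restrict_of_ae ht)
  · rw [integral_undef hG]
    filter_upwards [Lp.coeFn_zero ℂ 2 μ] with x hx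
    rw [hx]
    simpa using hM

lemma ae_norm_le_of_eLpNorm_top_le {g : Ω → ℂ} {M : ℝ} (hM : 0 ≤ M)
    (h : eLpNorm g ⊤ μ ≤ ENNReal.ofReal M) : ∀ᵐ x ∂μ, ‖g x‖ ≤ M := by
  rw [eLpNorm_exponent_top] at h
  filter_upwards [ae_le_eLpNormEssSup (f := g) (μ := μ)] with x hx
  rw [← ENNReal.ofReal_le_ofReal_iff hM, ofReal_norm]
  exact hx.trans h

lemma eLpNorm_top_le_of_ae_norm_le {g : Ω → ℂ} {M : ℝ}
    (h : ∀ᵐ x ∂μ, ‖g x‖ ≤ M) : eLpNorm g ⊤ μ ≤ ENNReal.ofReal M := by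
  rw [eLpNorm_exponent_top]
  exact eLpNormEssSup_le_of_ae_bound h

/-- If every combination `∑ cᵢ uᵢ` is the image, under a map bounded from `L²` to `L^∞`, of a
vector of norm at most `‖c‖`, then the square function of `u` is bounded almost everywhere. -/
lemma ae_sum_sq_norm_le {κ : Type*} [Fintype κ] {S : Lp ℂ 2 μ → Lp ℂ 2 μ} {K : ℝ} (hK : 0 ≤ K)
    (hS : ∀ w, ∀ᵐ x ∂μ, ‖S w x‖ ≤ K * ‖w‖) (u : κ → Lp ℂ 2 μ)
    (hu : ∀ c : EuclideanSpace ℂ κ, ∃ w, ‖w‖ ≤ ‖c‖ ∧ S w = ∑ i, c i • u i) :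
    ∀ᵐ x ∂μ, ∑ i, ‖u i x‖ ^ 2 ≤ K ^ 2 := by
  have key : ∀ᵐ x ∂μ, ‖(WithLp.toLp 2 fun i => u i x : EuclideanSpace ℂ κ)‖ ≤ K := by
    refine ae_norm_le_of_forall_ae_re_inner_le hK fun c => ?_
    obtain ⟨w, hw, hwu⟩ := hu (WithLp.toLp 2 fun i => star (c i))
    have h_star : ‖(WithLp.toLp 2 fun i => star (c i) : EuclideanSpace ℂ κ)‖ = ‖c‖ := by
      simp [EuclideanSpace.norm_eq]
    have h_smul : ∀ᵐ x ∂μ, ∀ i, (star (c i) • u i : Lp ℂ 2 μ) x = star (c i) • u i x :=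
      ae_all_iff.2 fun i => Lp.coeFn_smul _ _
    filter_upwards [hS w, h_smul, Lp.coeFn_finsetSum (Finset.univ) fun i => star (c i) • u i]
      with x hx hsm hsum
    have h_eq : inner ℂ c (WithLp.toLp 2 fun i => u i x : EuclideanSpace ℂ κ) = S w x := by
      rw [hwu, hsum, Finset.sum_apply, PiLp.inner_apply]
      refine Finset.sum_congr rfl fun i _ => ?_
      rw [hsm]
      simp [mul_comm]
    rw [h_eq]
    calc (S w x).re ≤ ‖S w x‖ := Complex.re_le_norm _
      _ ≤ K * ‖w‖ := hx
      _ ≤ K * ‖c‖ := by rw [← h_star]; gcongr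
  filter_upwards [key] with x hx
  have := pow_le_pow_left₀ (norm_nonneg _) hx 2
  rwa [EuclideanSpace.norm_sq_eq] at this

end AEBounds

lemma Orthonormal.norm_sum_smul_le {V κ : Type*} [NormedAddCommGroup V] [InnerProductSpace ℂ V]
    [Fintype κ] {v : κ → V} (hv : Orthonormal ℂ v) {d : κ → ℂ} (c : EuclideanSpace ℂ κ)
    (hd : ∀ i, ‖d i‖ ≤ ‖c i‖) : ‖∑ i, d i • v i‖ ≤ ‖c‖ := by
  refine le_of_sq_le_sq ?_ (norm_nonneg _)
  have h_inner := hv.inner_sum d d Finset.univ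
  have h_sq : ‖∑ i, d i • v i‖ ^ 2 = ∑ i, ‖d i‖ ^ 2 := by
    rw [← inner_self_eq_norm_sq (𝕜 := ℂ), h_inner, map_sum]
    refine Finset.sum_congr rfl fun i _ => ?_
    rw [Complex.conj_mul', ← Complex.ofReal_pow]
    exact Complex.ofReal_re _
  rw [h_sq, EuclideanSpace.norm_sq_eq]
  exact Finset.sum_le_sum fun i _ => pow_le_pow_left₀ (norm_nonneg _) (hd i) 2

/-- The weighted integral of an operator family maps a suitable truncation of `∑ cᵢ vᵢ` to
`∑ cᵢ uᵢ`, where `uᵢ` is the (possibly junk) integral associated with `vᵢ`. -/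
lemma exists_integral_apply_eq_sum {V κ T : Type*} [NormedAddCommGroup V] [InnerProductSpace ℂ V]
    [NormedSpace ℝ V] [SMulCommClass ℝ ℂ V] [CompleteSpace V] [Fintype κ]
    {mT : MeasurableSpace T} {ν : Measure T}
    (A : T → V →L[ℂ] V) (w : T → ℝ) {v : κ → V} (hv : Orthonormal ℂ v)
    (c : EuclideanSpace ℂ κ) :
    ∃ f, ‖f‖ ≤ ‖c‖ ∧ ∫ t, w t • A t f ∂ν = ∑ i, c i • ∫ t, w t • A t (v i) ∂ν := by
  classical
  set d : κ → ℂ := fun i => if Integrable (fun t => w t • A t (v i)) ν then c i else 0 with hd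
  refine ⟨∑ i, d i • v i, hv.norm_sum_smul_le c fun i => ?_, ?_⟩
  · by_cases hi : Integrable (fun t => w t • A t (v i)) ν <;> simp [hd, hi]
  · have h_expand : ∀ t, w t • A t (∑ i, d i • v i) = ∑ i, d i • (w t • A t (v i)) := fun t => by
      simp only [map_sum, map_smul, Finset.smul_sum]
      exact Finset.sum_congr rfl fun i _ => smul_comm _ _ _
    simp_rw [h_expand]
    rw [integral_finsetSum]
    · refine Finset.sum_congr rfl fun i _ => ?_
      rw [integral_smul]
      by_cases hi : Integrable (fun t => w t • A t (v i)) ν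
      · simp [hd, hi]
      · simp [integral_undef hi]
    · intro i _
      by_cases hi : Integrable (fun t => w t • A t (v i)) ν
      · exact hi.smul (d i)
      · simp [hd, hi]

lemma integrableOn_rpow_mul_exp_neg_mul {a r : ℝ} (ha : 0 < a) (hr : 0 < r) :
    IntegrableOn (fun t : ℝ => t ^ (a - 1) * Real.exp (-(r * t))) (Set.Ioi 0) := by
  simpa using integrableOn_rpow_mul_exp_neg_mul_rpow (p := 1) (s := a - 1) (by linarith)
    one_pos hr

/-- `L² → L^∞` bound for the Laplace transform of a family with `L² → L^∞` decay. -/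
lemma ae_norm_laplace_le {Ω : Type*} {mΩ : MeasurableSpace Ω} {μ : Measure Ω} [SigmaFinite μ]
    {A : ℝ → Lp ℂ 2 μ →L[ℂ] Lp ℂ 2 μ} {C γ α ε : ℝ} (hC : 0 ≤ C) (hγ : 0 < γ) (hα : γ < α)
    (hε : 0 < ε) (f : Lp ℂ 2 μ)
    (h : ∀ t : ℝ, 0 < t → ∀ᵐ x ∂μ, ‖A t f x‖ ≤ C * t ^ (-γ) * ‖f‖) :
    ∀ᵐ x ∂μ, ‖((Real.Gamma α)⁻¹ • ∫ t in Set.Ioi (0 : ℝ),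
        (Real.exp (-(t * ε)) * t ^ (α - 1)) • A t f : Lp ℂ 2 μ) x‖ ≤
      C * Real.Gamma (α - γ) / Real.Gamma α * ε ^ (γ - α) * ‖f‖ := by
  have hΓ : 0 < Real.Gamma α := Real.Gamma_pos_of_pos (hγ.trans hα)
  have h_bound := ae_norm_integral_le_of_ae_bound (μ := μ) (ν := volume.restrict (Set.Ioi (0 : ℝ)))
    (G := fun t => (Real.exp (-(t * ε)) * t ^ (α - 1)) • A t f)
    (φ := fun t => t ^ (α - γ - 1) * Real.exp (-(ε * t)) * (C * ‖f‖))
    ((integrableOn_rpow_mul_exp_neg_mul (sub_pos.2 hα) hε).mul_const _)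
    ((ae_restrict_iff' measurableSet_Ioi).2 (.of_forall fun t (ht : 0 < t) => by
      simp only [Pi.zero_apply]; positivity))
    ((ae_restrict_iff' measurableSet_Ioi).2 (.of_forall fun t (ht : 0 < t) => by
      filter_upwards [h t ht, Lp.coeFn_smul (Real.exp (-(t * ε)) * t ^ (α - 1)) (A t f)]
        with x hx hsm
      rw [hsm, Pi.smul_apply, norm_smul, Real.norm_of_nonneg (by positivity)]
      have h_pow : t ^ (α - γ - 1) = t ^ (α - 1) * t ^ (-γ) := by
        rw [← Real.rpow_add ht]; ring_nf
      calc _ ≤ Real.exp (-(t * ε)) * t ^ (α - 1) * (C * t ^ (-γ) * ‖f‖) := by gcongr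
        _ = _ := by rw [h_pow, mul_comm ε t]; ring))
  rw [integral_mul_const, Real.integral_rpow_mul_exp_neg_mul_Ioi (sub_pos.2 hα) hε] at h_bound
  have h_pow : (1 / ε) ^ (α - γ) = ε ^ (γ - α) := by
    rw [one_div, Real.inv_rpow hε.le, ← Real.rpow_neg hε.le, neg_sub]
  rw [h_pow] at h_bound
  filter_upwards [h_bound, Lp.coeFn_smul (Real.Gamma α)⁻¹ (∫ t in Set.Ioi (0 : ℝ),
    (Real.exp (-(t * ε)) * t ^ (α - 1)) • A t f)] with x hx hsm
  rw [hsm, Pi.smul_apply, norm_smul, Real.norm_of_nonneg (by positivity)]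
  calc _ ≤ (Real.Gamma α)⁻¹ * (ε ^ (γ - α) * Real.Gamma (α - γ) * (C * ‖f‖)) := by gcongr
    _ = _ := by ring

lemma sq_mul_volume_norm_le_le (m : ℕ) {K e R : ℝ} (hR : 0 < R) :
    ENNReal.ofReal ((K * e) ^ 2) * volume {x : EuclideanSpace ℝ (Fin m) | ‖x‖ ≤ R} ≤
      ENNReal.ofReal ((K * (1 + volume.real (Metric.closedBall (0 : EuclideanSpace ℝ (Fin m)) 1)) *
        R ^ ((m : ℝ) / 2) * e) ^ 2) := by
  have h_ball : {x : EuclideanSpace ℝ (Fin m) | ‖x‖ ≤ R} = Metric.closedBall 0 R := by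
    ext x; simp
  set v := volume.real (Metric.closedBall (0 : EuclideanSpace ℝ (Fin m)) 1) with hv
  have hv0 : 0 ≤ v := measureReal_nonneg
  have h_pow : (R ^ ((m : ℝ) / 2)) ^ 2 = R ^ m := by
    rw [← Real.rpow_natCast, ← Real.rpow_mul hR.le, ← Real.rpow_natCast]
    norm_num
  have h_vol : volume (Metric.closedBall (0 : EuclideanSpace ℝ (Fin m)) R) =
      ENNReal.ofReal (R ^ m * v) := by
    rw [Measure.addHaar_closedBall' _ _ hR.le, finrank_euclideanSpace_fin,
      ENNReal.ofReal_mul (by positivity), hv, ofReal_measureReal measure_closedBall_lt_top.ne]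
  rw [h_ball, h_vol, ← ENNReal.ofReal_mul (by positivity)]
  refine ENNReal.ofReal_le_ofReal ?_
  calc (K * e) ^ 2 * (R ^ m * v) ≤ (K * e) ^ 2 * (R ^ m * (1 + v) ^ 2) := by
        gcongr; nlinarith
    _ = _ := by rw [← h_pow]; ring

lemma ennnorm_sq_le_ofReal_sq {z : ℂ} {M : ℝ} (h : ‖z‖ ≤ M) :
    (‖z‖₊ : ℝ≥0∞) ^ 2 ≤ ENNReal.ofReal (M ^ 2) := by
  rw [ENNReal.ofReal_pow ((norm_nonneg z).trans h)]
  gcongr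
  rw [← enorm_eq_nnnorm, ← ofReal_norm]
  exact ENNReal.ofReal_le_ofReal h

variable (n : ℕ)

local notation "E" => EuclideanSpace ℝ (Fin n)
local notation "L2" => MeasureTheory.Lp ℂ 2 (volume : Measure (EuclideanSpace ℝ (Fin n)))

/-- **Resolvent-power bounds and Hilbert–Schmidt property from heat-kernel decay.**
Let `n ≥ 1` and let `H` be a non-negative self-adjoint operator on `L²(ℝⁿ)`, represented by
its heat semigroup `heat t = e^{−tH}` (a self-adjoint contraction semigroup), satisfying the
decay `‖e^{−tH}‖_{L²→L^∞} ≤ C t^{−γ}` for all `t > 0` and some `γ > 0`.  For `α, ε₀ > 0` let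
`(H+ε₀)^{−α}` be defined via the Laplace transform
`(H+ε₀)^{−α} = Γ(α)^{−1} ∫₀^∞ e^{−tH} e^{−tε₀} t^{α−1} dt` (hypothesis `hRes`).
Then for every `α > γ` there is `C' > 0` such that for all `ε₀ > 0`:
(a) `‖(H+ε₀)^{−α}‖_{L²→L^∞} ≤ C' ε₀^{γ−α}`; and
(b) for every `R > 0`, `χ(|x| ≤ R)(H+ε₀)^{−α}` is Hilbert–Schmidt, with Hilbert–Schmidt norm
(computed with respect to any Hilbert basis) at most `C' R^{n/2} ε₀^{γ−α}`, and hence its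
operator norm obeys the same bound. -/
theorem resolvent_power_hilbert_schmidt
    (hn : 1 ≤ n)
    (heat : ℝ → (L2 →L[ℂ] L2))
    (hheat_zero : heat 0 = 1)
    (hheat_add : ∀ s t : ℝ, 0 ≤ s → 0 ≤ t → heat (s + t) = (heat s).comp (heat t))
    (hheat_sa : ∀ t : ℝ, 0 ≤ t → IsSelfAdjoint (heat t))
    (hheat_contr : ∀ t : ℝ, 0 ≤ t → ‖heat t‖ ≤ 1)
    (C γ : ℝ) (hC : 0 < C) (hγ : 0 < γ)
    (hdecay : ∀ t : ℝ, 0 < t → ∀ f : L2,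
      eLpNorm (⇑(heat t f)) ⊤ volume ≤ ENNReal.ofReal (C * t ^ (-γ) * ‖f‖))
    (Res : ℝ → ℝ → L2 → L2)
    (hRes : ∀ (α ε₀ : ℝ) (f : L2), Res α ε₀ f =
      (Real.Gamma α)⁻¹ • ∫ t in Set.Ioi (0 : ℝ),
        (Real.exp (-(t * ε₀)) * t ^ (α - 1)) • heat t f) :
    ∀ α : ℝ, γ < α → ∃ C' > (0 : ℝ), ∀ ε₀ : ℝ, 0 < ε₀ →
      (∀ f : L2, eLpNorm (⇑(Res α ε₀ f)) ⊤ volume ≤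
        ENNReal.ofReal (C' * ε₀ ^ (γ - α) * ‖f‖)) ∧
      (∀ R : ℝ, 0 < R →
        (∀ (ι : Type) (b : HilbertBasis ι ℂ L2),
          (∑' i : ι, ∫⁻ x in {x : E | ‖x‖ ≤ R}, (‖Res α ε₀ (b i) x‖₊ : ℝ≥0∞) ^ 2) ≤
            ENNReal.ofReal ((C' * R ^ ((n : ℝ) / 2) * ε₀ ^ (γ - α)) ^ 2)) ∧
        (∀ f : L2, (∫⁻ x in {x : E | ‖x‖ ≤ R}, (‖Res α ε₀ f x‖₊ : ℝ≥0∞) ^ 2) ≤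
          ENNReal.ofReal ((C' * R ^ ((n : ℝ) / 2) * ε₀ ^ (γ - α) * ‖f‖) ^ 2))) := by
  intro α hα
  set K₀ : ℝ := C * Real.Gamma (α - γ) / Real.Gamma α
  have hK₀_pos : 0 < K₀ :=
    div_pos (mul_pos hC (Real.Gamma_pos_of_pos (sub_pos.2 hα)))
      (Real.Gamma_pos_of_pos (hγ.trans hα))
  set v := volume.real (Metric.closedBall (0 : E) 1)
  have hv0 : 0 ≤ v := measureReal_nonneg
  refine ⟨K₀ * (1 + v), by positivity, fun ε hε => ?_⟩
  have h_ae : ∀ f : L2, ∀ᵐ x, ‖Res α ε f x‖ ≤ K₀ * ε ^ (γ - α) * ‖f‖ := fun f => by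
    rw [hRes]
    exact ae_norm_laplace_le hC.le hγ hα hε f fun t ht =>
      ae_norm_le_of_eLpNorm_top_le (by positivity) (hdecay t ht f)
  refine ⟨fun f => eLpNorm_top_le_of_ae_norm_le ?_, fun R hR => ⟨fun ι b => ?_, fun f => ?_⟩⟩
  · filter_upwards [h_ae f] with x hx
    refine hx.trans ?_
    gcongr
    nlinarith
  · rw [ENNReal.tsum_eq_iSup_sum]
    refine iSup_le fun s => ?_
    have h_sq := ae_sum_sq_norm_le (by positivity) h_ae (fun i : s => Res α ε (b i)) fun c => by
      obtain ⟨f, hf, hf_eq⟩ := exists_integral_apply_eq_sum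
        (ν := volume.restrict (Set.Ioi (0 : ℝ))) heat
        (fun t => Real.exp (-(t * ε)) * t ^ (α - 1))
        (b.orthonormal.comp (Subtype.val : s → ι) Subtype.val_injective) c
      refine ⟨f, hf, ?_⟩
      rw [hRes, hf_eq, Finset.smul_sum]
      refine Finset.sum_congr rfl fun i _ => ?_
      rw [smul_comm, hRes]
      rfl
    simp only [← enorm_eq_nnnorm]
    rw [← lintegral_finsetSum _ fun i _ =>
      (Lp.stronglyMeasurable (Res α ε (b i))).enorm.pow_const 2]
    refine le_trans ?_ (sq_mul_volume_norm_le_le n hR)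
    rw [← setLIntegral_const]
    refine lintegral_mono_ae (ae_restrict_of_ae ?_)
    filter_upwards [h_sq] with x hx
    rw [Finset.sum_coe_sort s fun i => ‖Res α ε (b i) x‖ ^ 2] at hx
    calc ∑ i ∈ s, ‖Res α ε (b i) x‖ₑ ^ 2
        ≤ ∑ i ∈ s, ENNReal.ofReal (‖Res α ε (b i) x‖ ^ 2) :=
          Finset.sum_le_sum fun i _ => ennnorm_sq_le_ofReal_sq le_rfl
      _ = ENNReal.ofReal (∑ i ∈ s, ‖Res α ε (b i) x‖ ^ 2) :=
          (ENNReal.ofReal_sum_of_nonneg fun i _ => sq_nonneg _).symm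
      _ ≤ ENNReal.ofReal ((K₀ * ε ^ (γ - α)) ^ 2) := ENNReal.ofReal_le_ofReal hx
  · rw [mul_assoc (K₀ * (1 + v) * R ^ ((n : ℝ) / 2))]
    refine le_trans ?_ (sq_mul_volume_norm_le_le n hR)
    rw [← setLIntegral_const]
    refine lintegral_mono_ae (ae_restrict_of_ae ?_)
    filter_upwards [h_ae f] with x hx
    exact ennnorm_sq_le_ofReal_sq (by rwa [← mul_assoc])

end
end
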